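/- Let G be the dihedral group of order 8, W the 7-dimensional sum-zero subrepresentation of its complex left regular representation, and Sym²W its symmetric square with the induced G-action. Let U = Fin 3 → (G → ℂ) be the direct sum of three copies of the left regular representation of G, with action (g • u)(j)(x) = u(j)(g⁻¹ x). Then there is no surjective ℂ-linear map F : Sym²W → U that is G-equivariant, i.e., satisfying F(g • w) = g • F(w) for all g ∈ G and w ∈ Sym²W. -/

import Mathlib

open scoped TensorProduct

set_option synthInstance.maxHeartbeats 1000000
set_option maxHeartbeats 1000000

/-- The left regular action of `g` on functions `DihedralGroup 4 → ℂ`: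
`(reg g f) x = f (g⁻¹ * x)`. -/
noncomputable def reg (g : DihedralGroup 4) :
    (DihedralGroup 4 → ℂ) →ₗ[ℂ] (DihedralGroup 4 → ℂ) :=
  LinearMap.funLeft ℂ ℂ (fun x => g⁻¹ * x)

/-- The subspace of sum-zero functions: the regular representation minus the
trivial representation; it is 7-dimensional. -/
noncomputable def W : Submodule ℂ (DihedralGroup 4 → ℂ) :=
  LinearMap.ker (∑ x : DihedralGroup 4, LinearMap.proj x :
    (DihedralGroup 4 → ℂ) →ₗ[ℂ] ℂ)

lemma reg_mem_W (g : DihedralGroup 4) {f : DihedralGroup 4 → ℂ} (hf : f ∈ W) :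
    reg g f ∈ W := by
  simp only [W, LinearMap.mem_ker, LinearMap.sum_apply, LinearMap.proj_apply] at hf ⊢
  calc ∑ x : DihedralGroup 4, reg g f x
      = ∑ x : DihedralGroup 4, f x :=
        Fintype.sum_equiv (Equiv.mulLeft g⁻¹) _ _ (fun x => rfl)
    _ = 0 := hf

/-- The action of `g` on `W`. -/
noncomputable def regW (g : DihedralGroup 4) : W →ₗ[ℂ] W :=
  (reg g).restrict (fun _ hf => reg_mem_W g hf)

noncomputable instance : AddCommGroup (↥W ⊗[ℂ] ↥W) := TensorProduct.addCommGroup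

/-- The diagonal action of `g` on `W ⊗ W`. -/
noncomputable def tenAct (g : DihedralGroup 4) : (↥W ⊗[ℂ] ↥W) →ₗ[ℂ] (↥W ⊗[ℂ] ↥W) :=
  TensorProduct.map (regW g) (regW g)

/-- The subspace of `W ⊗ W` spanned by the elements `x ⊗ y - y ⊗ x`. -/
noncomputable def symRel : Submodule ℂ (↥W ⊗[ℂ] ↥W) :=
  Submodule.span ℂ {z | ∃ x y : W, z = x ⊗ₜ[ℂ] y - y ⊗ₜ[ℂ] x}

/-- The symmetric square `Sym² W`: the quotient of `W ⊗ W` by the span of the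
elements `x ⊗ y - y ⊗ x`. -/
noncomputable abbrev Sym2W : Type := (↥W ⊗[ℂ] ↥W) ⧸ symRel

lemma symRel_le (g : DihedralGroup 4) : symRel ≤ symRel.comap (tenAct g) := by
  rw [symRel, Submodule.span_le]
  rintro z ⟨x, y, rfl⟩
  simp only [Submodule.mem_comap, map_sub, tenAct, TensorProduct.map_tmul]
  exact Submodule.subset_span ⟨regW g x, regW g y, rfl⟩

/-- The induced action of `g` on `Sym² W`. -/
noncomputable def symAct (g : DihedralGroup 4) : Sym2W →ₗ[ℂ] Sym2W :=
  Submodule.mapQ symRel symRel (tenAct g) (symRel_le g)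

/-- The action of `g` on `U = Fin 3 → (DihedralGroup 4 → ℂ)`, the direct sum of
three copies of the left regular representation: `(g • u) j x = u j (g⁻¹ x)`. -/
noncomputable def actU (g : DihedralGroup 4) :
    (Fin 3 → DihedralGroup 4 → ℂ) →ₗ[ℂ] (Fin 3 → DihedralGroup 4 → ℂ) :=
  LinearMap.pi fun j => (reg g).comp (LinearMap.proj j)

/-- The linear character of `DihedralGroup 4` that is `1` on rotations and `-1` on reflections. -/
def rotSign : DihedralGroup 4 → ℂ
  | .r _ => 1
  | .sr _ => -1

lemma rotSign_mul (g h : DihedralGroup 4) : rotSign (g * h) = rotSign g * rotSign h := by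
  cases g <;> cases h <;> simp [rotSign]

lemma mem_W_iff (f : DihedralGroup 4 → ℂ) : f ∈ W ↔ ∑ x, f x = 0 := by
  simp [W, LinearMap.mem_ker]

lemma card_dihedralGroup_four : Fintype.card (DihedralGroup 4) = 8 := by
  rw [DihedralGroup.card]

/-- The projection to `W` of the indicator function of `x`. -/
noncomputable def projSingle (x : DihedralGroup 4) : W :=
  ⟨fun y => (if y = x then 1 else 0) - 1 / 8, by
    rw [mem_W_iff]
    simp [Finset.sum_sub_distrib, card_dihedralGroup_four]⟩

lemma regW_projSingle (g x : DihedralGroup 4) :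
    regW g (projSingle x) = projSingle (g * x) := by
  ext y
  simp [regW, reg, projSingle, LinearMap.restrict_apply, LinearMap.funLeft_apply,
    inv_mul_eq_iff_eq_mul]

lemma sum_projSingle : ∑ x, projSingle x = 0 := by
  ext y
  simp [projSingle, Finset.sum_sub_distrib, card_dihedralGroup_four]

lemma eq_sum_smul_projSingle (f : W) : f = ∑ x, (f : DihedralGroup 4 → ℂ) x • projSingle x := by
  have hf := (mem_W_iff _).1 f.2
  ext y
  simp [projSingle, mul_sub, Finset.sum_sub_distrib, ← Finset.sum_mul, hf]

/-- The product `f₁ f₂` in `Sym² W`, as a bilinear map. -/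
noncomputable def symMul : W →ₗ[ℂ] W →ₗ[ℂ] Sym2W :=
  (TensorProduct.mk ℂ W W).compr₂ symRel.mkQ

lemma symMul_comm (f₁ f₂ : W) : symMul f₁ f₂ = symMul f₂ f₁ :=
  (Submodule.Quotient.eq symRel).2 (Submodule.subset_span ⟨f₁, f₂, rfl⟩)

lemma symAct_symMul (g : DihedralGroup 4) (f₁ f₂ : W) :
    symAct g (symMul f₁ f₂) = symMul (regW g f₁) (regW g f₂) := rfl

/-- A linear functional on `Sym² W` vanishing on all products of projected indicators is zero. -/
lemma functional_eq_zero_of_projSingle {L : Sym2W →ₗ[ℂ] ℂ}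
    (h : ∀ x y, L (symMul (projSingle x) (projSingle y)) = 0) : L = 0 := by
  apply Submodule.linearMap_qext
  apply TensorProduct.ext'
  intro f₁ f₂
  change L (symMul f₁ f₂) = 0
  rw [eq_sum_smul_projSingle f₁, eq_sum_smul_projSingle f₂]
  simp only [map_sum, map_smul, LinearMap.sum_apply, LinearMap.smul_apply, h, smul_zero,
    Finset.sum_const_zero]

lemma sum_dihedralGroup_four {M : Type*} [AddCommMonoid M] (c : DihedralGroup 4 → M) :
    ∑ x, c x = (c (.r 0) + c (.r 1) + c (.r 2) + c (.r 3)) +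
      (c (.sr 0) + c (.sr 1) + c (.sr 2) + c (.sr 3)) := by
  have hu : (Finset.univ : Finset (DihedralGroup 4)) =
    {.r 0, .r 1, .r 2, .r 3, .sr 0, .sr 1, .sr 2, .sr 3} := by decide
  rw [hu]
  repeat rw [Finset.sum_insert (by decide)]
  rw [Finset.sum_singleton]
  simp only [add_assoc]

/-- A functional on `Sym² W` transforming by `rotSign` is determined by two of its values. -/
lemma functional_eq_zero {L : Sym2W →ₗ[ℂ] ℂ}
    (hL : ∀ g w, L (symAct g w) = rotSign g * L w)
    (h0 : L (symMul (projSingle 1) (projSingle 1)) = 0)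
    (h1 : L (symMul (projSingle 1) (projSingle (.r 1))) = 0) : L = 0 := by
  have equiv (g x y : DihedralGroup 4) : L (symMul (projSingle (g * x)) (projSingle (g * y))) =
      rotSign g * L (symMul (projSingle x) (projSingle y)) := by
    rw [← hL, symAct_symMul, regW_projSingle, regW_projSingle]
  have inv (x : DihedralGroup 4) : L (symMul (projSingle 1) (projSingle x)) =
      rotSign x * L (symMul (projSingle 1) (projSingle x⁻¹)) := by
    rw [← equiv, mul_one, mul_inv_cancel, symMul_comm]
  have hsr (i : ZMod 4) : L (symMul (projSingle 1) (projSingle (.sr i))) = 0 := by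
    have h := inv (.sr i)
    rw [DihedralGroup.inv_sr, rotSign] at h
    linear_combination h / 2
  have h3 : L (symMul (projSingle 1) (projSingle (.r 3))) = 0 := by
    have h := inv (.r 3)
    rwa [show (DihedralGroup.r 3 : DihedralGroup 4)⁻¹ = .r 1 by decide, h1, mul_zero] at h
  have h2 : L (symMul (projSingle 1) (projSingle (.r 2))) = 0 := by
    have h : L (symMul (projSingle 1) (∑ x, projSingle x)) = 0 := by
      rw [sum_projSingle, map_zero, map_zero]
    rw [sum_dihedralGroup_four] at h
    simpa only [map_add, hsr, h3, h1, ← DihedralGroup.one_def, h0, add_zero, zero_add] using h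
  have hr (i : ZMod 4) : L (symMul (projSingle 1) (projSingle (.r i))) = 0 := by
    fin_cases i
    exacts [h0, h1, h2, h3]
  refine functional_eq_zero_of_projSingle fun x y => ?_
  have h := equiv x 1 (x⁻¹ * y)
  rw [mul_one, mul_inv_cancel_left] at h
  rw [h]
  rcases x⁻¹ * y with i | i
  · rw [hr, mul_zero]
  · rw [hsr, mul_zero]

/-- The `rotSign`-weighted sum of the components of an element of the triple regular
representation, combined with coefficients `a`. -/
noncomputable def weightedSum (a : Fin 3 → ℂ) : (Fin 3 → DihedralGroup 4 → ℂ) →ₗ[ℂ] ℂ :=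
  ∑ j, ∑ x, (a j * rotSign x) • ((LinearMap.proj x : (DihedralGroup 4 → ℂ) →ₗ[ℂ] ℂ) ∘ₗ LinearMap.proj j)

lemma weightedSum_apply (a : Fin 3 → ℂ) (u : Fin 3 → DihedralGroup 4 → ℂ) :
    weightedSum a u = ∑ j, a j * ∑ x, rotSign x * u j x := by
  simp [weightedSum, LinearMap.sum_apply, Finset.mul_sum, mul_assoc]

lemma weightedSum_actU (a : Fin 3 → ℂ) (g : DihedralGroup 4)
    (u : Fin 3 → DihedralGroup 4 → ℂ) :
    weightedSum a (actU g u) = rotSign g * weightedSum a u := by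
  simp only [weightedSum_apply, Finset.mul_sum]
  refine Finset.sum_congr rfl fun j _ => ?_
  refine (Fintype.sum_equiv (Equiv.mulLeft g) _ _ fun x => ?_).symm
  change rotSign g * (a j * (rotSign x * u j x)) =
    a j * (rotSign (g * x) * u j (g⁻¹ * (g * x)))
  rw [inv_mul_cancel_left, rotSign_mul]
  ring

lemma eq_zero_of_weightedSum_eq_zero {a : Fin 3 → ℂ} (h : weightedSum a = 0) : a = 0 := by
  funext j
  have hj := LinearMap.congr_fun h (Pi.single j (Pi.single 1 1))
  rw [weightedSum_apply, Finset.sum_eq_single j (fun i _ hi => by simp [hi]) (by simp)] at hj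
  rw [Pi.single_eq_same, Finset.sum_eq_single 1 (fun x _ hx => by simp [hx]) (by simp)] at hj
  simpa only [Pi.single_eq_same, DihedralGroup.one_def, rotSign, mul_one, LinearMap.zero_apply,
    Pi.zero_apply] using hj

/-- There is no surjective `G`-equivariant linear map from `Sym² W` onto the sum
`U` of three copies of the regular representation of `G = D₄`.  This is the key
representation-theoretic fact behind the proof that the dihedral group of order 8
is not the fundamental group of a Campedelli surface. -/
theorem no_equivariant_surjection_sym2_to_triple_regular :
    ¬ ∃ F : Sym2W →ₗ[ℂ] (Fin 3 → DihedralGroup 4 → ℂ),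
      Function.Surjective F ∧
      ∀ (g : DihedralGroup 4) (w : Sym2W), F (symAct g w) = actU g (F w) := by
  rintro ⟨F, hF, hequiv⟩
  let m : Fin 2 → Sym2W := ![symMul (projSingle 1) (projSingle 1),
    symMul (projSingle 1) (projSingle (.r 1))]
  let A : Matrix (Fin 2) (Fin 3) ℂ := fun i j => ∑ x, rotSign x * F (m i) j x
  obtain ⟨a, ha, ha0⟩ := (Submodule.ne_bot_iff _).1
    (LinearMap.ker_ne_bot_of_finrank_lt (f := A.mulVecLin) (by simp))
  have hA (i : Fin 2) : weightedSum a (F (m i)) = 0 := by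
    rw [weightedSum_apply]
    simp_rw [mul_comm (a _)]
    exact congrFun (LinearMap.mem_ker.1 ha) i
  have hL : weightedSum a ∘ₗ F = 0 :=
    functional_eq_zero (fun g w => by simp [hequiv, weightedSum_actU]) (hA 0) (hA 1)
  refine ha0 (eq_zero_of_weightedSum_eq_zero (LinearMap.ext fun u => ?_))
  obtain ⟨w, rfl⟩ := hF u
  exact LinearMap.congr_fun hL w
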